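/- arXiv:math/0306114 — 2 statements merged into one kernel-verified Lean document; each statement's English description precedes it below -/
import Mathlib

section
/- The right ideal ℛ = R·A(U_q(4)) is a two-sided coideal of A(U_q(4)) (i.e. Δ(ℛ) ⊆ ℛ ⊗ A(U_q(4)) + A(U_q(4)) ⊗ ℛ and ε(ℛ) = 0) and is invariant under the antilinear map κ = * ∘ S (i.e. κ(ℛ) ⊆ ℛ). -/
open scoped TensorProduct

noncomputable section

namespace QIB

/-- Generators of `A(U_q(4))`: the matrix entries `t i j` and the extra generator `D_q⁻¹`. -/
abbrev genU : Type := (Fin 4 × Fin 4) ⊕ Unit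

abbrev FU : Type := FreeAlgebra ℂ genU

def T (i j : Fin 4) : FU := FreeAlgebra.ι ℂ (Sum.inl (i, j))

def Dinv0 : FU := FreeAlgebra.ι ℂ (Sum.inr ())

/-- The length (number of inversions) of a permutation of `Fin 4`. -/
def plen (σ : Equiv.Perm (Fin 4)) : ℕ :=
  ((Finset.univ : Finset (Fin 4 × Fin 4)).filter fun p => p.1 < p.2 ∧ σ p.2 < σ p.1).card

/-- The quantum determinant, as an element of the free algebra. -/
def Dq0 (q : ℝ) : FU :=
  ∑ σ : Equiv.Perm (Fin 4),
    ((-(q : ℂ)) ^ plen σ) • (T (σ 0) 0 * T (σ 1) 1 * T (σ 2) 2 * T (σ 3) 3)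

/-- The defining relations of `A(U_q(4))`. -/
inductive relU (q : ℝ) : FU → FU → Prop
  | col {i j k : Fin 4} : i < j → relU q (T i k * T j k) ((q : ℂ) • (T j k * T i k))
  | row {i j k : Fin 4} : i < j → relU q (T k i * T k j) ((q : ℂ) • (T k j * T k i))
  | comm {i j k l : Fin 4} : i < j → k < l → relU q (T i l * T j k) (T j k * T i l)
  | qcom {i j k l : Fin 4} : i < j → k < l →
      relU q (T i k * T j l - T j l * T i k) (((q : ℂ) - (q : ℂ)⁻¹) • (T j k * T i l))
  | dr : relU q (Dq0 q * Dinv0) 1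
  | dl : relU q (Dinv0 * Dq0 q) 1

variable (q : ℝ)

/-- The algebra `A(U_q(4))`. -/
abbrev AU : Type := RingQuot (relU q)

/-- The generators `t i j` of `A(U_q(4))` (indices are 0-based). -/
def tt (i j : Fin 4) : AU q := RingQuot.mkAlgHom ℂ (relU q) (T i j)

/-- The generator `D_q⁻¹`. -/
def dI : AU q := RingQuot.mkAlgHom ℂ (relU q) Dinv0

/-- The quantum determinant `D_q` in `A(U_q(4))`. -/
def Dq : AU q := RingQuot.mkAlgHom ℂ (relU q) (Dq0 q)

/-- The spanning set `R` of relation elements (0-based indices). -/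
def Rset : Set (AU q) :=
  {tt q 0 2, tt q 2 0, tt q 0 3, tt q 3 0, tt q 1 3, tt q 3 1, tt q 1 2, tt q 2 1,
   tt q 0 0 - tt q 3 3, tt q 0 1 + tt q 3 2, tt q 1 0 + tt q 2 3, tt q 1 1 - tt q 2 2,
   tt q 0 0 * tt q 1 1 - (q : ℂ) • (tt q 0 1 * tt q 1 0) - 1}

/-- The right ideal `ℛ = R · A(U_q(4))`, as a `ℂ`-submodule. -/
def RIdeal : Submodule ℂ (AU q) :=
  Submodule.span ℂ {y | ∃ x ∈ Rset q, ∃ a : AU q, y = x * a}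

/-- The coalgebra `C = A(U_q(4)) / ℛ`. -/
abbrev Cq : Type := AU q ⧸ RIdeal q

/-- The canonical projection `r : A(U_q(4)) → C`. -/
def rr : AU q →ₗ[ℂ] Cq q := (RIdeal q).mkQ

lemma RIdeal_mul_right {y : AU q} (hy : y ∈ RIdeal q) (c : AU q) : y * c ∈ RIdeal q := by
  induction hy using Submodule.span_induction with
  | mem x hx =>
      obtain ⟨x0, hx0, a, rfl⟩ := hx
      exact Submodule.subset_span ⟨x0, hx0, a * c, by rw [mul_assoc]⟩
  | zero => simp
  | add u v _ _ hu hv => simpa [add_mul] using (RIdeal q).add_mem hu hv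
  | smul a u _ hu => simpa [smul_mul_assoc] using (RIdeal q).smul_mem a hu

/-- Auxiliary map for the right `A(U_q(4))`-module structure of `C`:
right multiplication by `c` descends to the quotient. -/
def cactAux (c : AU q) : Cq q →ₗ[ℂ] Cq q :=
  Submodule.liftQ (RIdeal q) ((RIdeal q).mkQ ∘ₗ LinearMap.mulRight ℂ c)
    (by
      intro y hy
      simp only [LinearMap.mem_ker, LinearMap.comp_apply, LinearMap.mulRight_apply,
        Submodule.mkQ_apply, Submodule.Quotient.mk_eq_zero]
      exact RIdeal_mul_right q hy c)

@[simp] lemma cactAux_mk (c a : AU q) :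
    cactAux q c (Submodule.Quotient.mk a) = (Submodule.Quotient.mk (a * c) : Cq q) := by
  simp [cactAux]

/-- The right `A(U_q(4))`-module structure `r(t) · t' := r(t t')` of `C`,
as a bilinear map `A(U_q(4)) →ₗ C →ₗ C`, `(c, x) ↦ x · c`. -/
def cact : AU q →ₗ[ℂ] Cq q →ₗ[ℂ] Cq q where
  toFun c := cactAux q c
  map_add' c c' := by
    refine LinearMap.ext fun x => ?_
    obtain ⟨a, rfl⟩ := Submodule.Quotient.mk_surjective _ x
    simp only [cactAux_mk, mul_add, Submodule.Quotient.mk_add, LinearMap.add_apply]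
  map_smul' s c := by
    refine LinearMap.ext fun x => ?_
    obtain ⟨a, rfl⟩ := Submodule.Quotient.mk_surjective _ x
    simp only [cactAux_mk, mul_smul_comm, Submodule.Quotient.mk_smul, RingHom.id_apply, LinearMap.smul_apply]

@[simp] lemma cact_mk (c a : AU q) : cact q c (rr q a) = rr q (a * c) := by
  simp [cact, rr]

/-- θ(k) = 1 for k ≥ 0 and 0 for k < 0. -/
def thetaZ (k : ℤ) : ℂ := if 0 ≤ k then 1 else 0

/-- The linear basis elements `r^{k,m,n}` of `C`, given as representatives in `A(U_q(4))`. -/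
def bas (k : ℤ) (m n : ℕ) : AU q :=
  if 0 ≤ k then tt q 0 0 ^ k.toNat * tt q 0 1 ^ m * tt q 1 0 ^ n
  else tt q 0 1 ^ m * tt q 1 0 ^ n * tt q 1 1 ^ (-k).toNat

/-! ### The quantum seven-sphere -/

/-- Generators of `A(S⁷_q)`: `(i, false)` is `z_i`, `(i, true)` is `z_i^*`. -/
abbrev genS : Type := Fin 4 × Bool

abbrev FS : Type := FreeAlgebra ℂ genS

def Z0 (i : Fin 4) : FS := FreeAlgebra.ι ℂ (i, false)

def Zs0 (i : Fin 4) : FS := FreeAlgebra.ι ℂ (i, true)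

/-- The defining relations of the ∗-algebra `A(S⁷_q)` (including the ∗-conjugate of the
first family of relations, so that the relation set is closed under the involution). -/
inductive relS (q : ℝ) : FS → FS → Prop
  | zz {i j : Fin 4} : i < j → relS q (Z0 i * Z0 j) ((q : ℂ) • (Z0 j * Z0 i))
  | ss {i j : Fin 4} : i < j → relS q (Zs0 j * Zs0 i) ((q : ℂ) • (Zs0 i * Zs0 j))
  | sz {i j : Fin 4} : i ≠ j → relS q (Zs0 j * Z0 i) ((q : ℂ) • (Z0 i * Zs0 j))
  | szz {k : Fin 4} : relS q (Zs0 k * Z0 k)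
      (Z0 k * Zs0 k + (1 - (q : ℂ) ^ 2) •
        ∑ j ∈ Finset.univ.filter (· < k), Z0 j * Zs0 j)
  | sum1 : relS q (∑ k : Fin 4, Z0 k * Zs0 k) 1

/-- The algebra `P = A(S⁷_q)`. -/
abbrev PA : Type := RingQuot (relS q)

/-- The generators `z_i` of `A(S⁷_q)` (0-based index). -/
def z (i : Fin 4) : PA q := RingQuot.mkAlgHom ℂ (relS q) (Z0 i)

/-- The generators `z_i^*` of `A(S⁷_q)` (0-based index). -/
def zs (i : Fin 4) : PA q := RingQuot.mkAlgHom ℂ (relS q) (Zs0 i)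

/-- The element `R = z₁ z₁^* + z₂ z₂^*` of `A(S⁷_q)`. -/
def RRe [StarRing (PA q)] : PA q := z q 0 * star (z q 0) + z q 1 * star (z q 1)

/-- The element `a = z₁ z₄^* − z₂ z₃^*` of `A(S⁷_q)`. -/
def aa [StarRing (PA q)] : PA q := z q 0 * star (z q 3) - z q 1 * star (z q 2)

/-- The element `b = z₁ z₃ + q⁻¹ z₂ z₄` of `A(S⁷_q)`. -/
def bb : PA q := z q 0 * z q 2 + (q : ℂ)⁻¹ • (z q 1 * z q 3)

/-- The elements `a_n = z₁ z₄^* − qⁿ z₂ z₃^*` of `A(S⁷_q)`. -/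
def aN [StarRing (PA q)] (n : ℤ) : PA q :=
  z q 0 * star (z q 3) - ((q : ℂ) ^ n) • (z q 1 * star (z q 2))

/-- The elements `b_n = z₁ z₃ + q^{n−1} z₂ z₄` of `A(S⁷_q)`. -/
def bN (n : ℤ) : PA q := z q 0 * z q 2 + ((q : ℂ) ^ (n - 1)) • (z q 1 * z q 3)

/-! ### The coaction, the coinvariants and the canonical map -/

variable (δ : PA q →ₐ[ℂ] PA q ⊗[ℂ] AU q)

/-- `Δ_r := (id ⊗ r) ∘ Δ : A(S⁷_q) → A(S⁷_q) ⊗ C`, built from the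
`A(U_q(4))`-coaction `δ`. -/
def Dr : PA q →ₗ[ℂ] PA q ⊗[ℂ] Cq q :=
  (LinearMap.lTensor (PA q) (rr q)) ∘ₗ δ.toLinearMap

/-- The set of coinvariants `B = A(Σ⁴_q) = {a | Δ_r(a) = a ⊗ r(1)}`. -/
def Bset : Set (PA q) := {a : PA q | Dr q δ a = a ⊗ₜ[ℂ] rr q 1}

/-- The subspace of `P ⊗ P` spanned by the elements `(u b) ⊗ v − u ⊗ (b v)` with `b`
a coinvariant; quotienting by it produces the balanced tensor product `P ⊗_B P`. -/
def relT : Submodule ℂ (PA q ⊗[ℂ] PA q) :=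
  Submodule.span ℂ
    {x : PA q ⊗[ℂ] PA q | ∃ u v b : PA q, b ∈ Bset q δ ∧
      x = (u * b) ⊗ₜ[ℂ] v - u ⊗ₜ[ℂ] (b * v)}

set_option maxSynthPendingDepth 3 in
/-- The balanced tensor product `P ⊗_B P` over the coinvariant subalgebra `B = A(Σ⁴_q)`. -/
abbrev PBP : Type := (PA q ⊗[ℂ] PA q) ⧸ relT q δ

set_option maxSynthPendingDepth 3 in
/-- The canonical projection `P ⊗ P → P ⊗_B P`. -/
def mkT : PA q ⊗[ℂ] PA q →ₗ[ℂ] PBP q δ := (relT q δ).mkQ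

lemma relT_map_lmul (p : PA q) {x : PA q ⊗[ℂ] PA q} (hx : x ∈ relT q δ) :
    TensorProduct.map (LinearMap.mulLeft ℂ p) LinearMap.id x ∈ relT q δ := by
  induction hx using Submodule.span_induction with
  | mem y hy =>
      obtain ⟨u, v, b, hb, rfl⟩ := hy
      refine Submodule.subset_span ⟨p * u, v, b, hb, ?_⟩
      simp [TensorProduct.map_tmul, mul_assoc]
  | zero => simp
  | add u v _ _ hu hv => simpa [map_add] using Submodule.add_mem _ hu hv
  | smul a u _ hu => simpa [map_smul] using Submodule.smul_mem _ a hu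

lemma relT_map_rmul (p : PA q) {x : PA q ⊗[ℂ] PA q} (hx : x ∈ relT q δ) :
    TensorProduct.map LinearMap.id (LinearMap.mulRight ℂ p) x ∈ relT q δ := by
  induction hx using Submodule.span_induction with
  | mem y hy =>
      obtain ⟨u, v, b, hb, rfl⟩ := hy
      refine Submodule.subset_span ⟨u, v * p, b, hb, ?_⟩
      simp [TensorProduct.map_tmul, mul_assoc]
  | zero => simp
  | add u v _ _ hu hv => simpa [map_add] using Submodule.add_mem _ hu hv
  | smul a u _ hu => simpa [map_smul] using Submodule.smul_mem _ a hu

set_option maxSynthPendingDepth 3 in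
/-- Left multiplication by `p ∈ P` on the bimodule `P ⊗_B P`. -/
def lact (p : PA q) : PBP q δ →ₗ[ℂ] PBP q δ :=
  Submodule.liftQ (relT q δ)
    ((relT q δ).mkQ ∘ₗ TensorProduct.map (LinearMap.mulLeft ℂ p) LinearMap.id)
    (by
      intro x hx
      simp only [LinearMap.mem_ker, LinearMap.comp_apply, Submodule.mkQ_apply,
        Submodule.Quotient.mk_eq_zero]
      exact relT_map_lmul q δ p hx)

set_option maxSynthPendingDepth 3 in
/-- Right multiplication by `p ∈ P` on the bimodule `P ⊗_B P`. -/
def ract (p : PA q) : PBP q δ →ₗ[ℂ] PBP q δ :=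
  Submodule.liftQ (relT q δ)
    ((relT q δ).mkQ ∘ₗ TensorProduct.map LinearMap.id (LinearMap.mulRight ℂ p))
    (by
      intro x hx
      simp only [LinearMap.mem_ker, LinearMap.comp_apply, Submodule.mkQ_apply,
        Submodule.Quotient.mk_eq_zero]
      exact relT_map_rmul q δ p hx)

/-- The structure map of the right action `◁` of `A(S⁷_q)` on `A(S⁷_q) ⊗ C`:
on simple tensors, `(u ⊗ x) ⊗ (w ⊗ y) ↦ (u w) ⊗ (x · y)`.  The action is
`(u ⊗ x) ◁ v = triMap ((u ⊗ x) ⊗ δ v) = Σ u v₍₀₎ ⊗ x · v₍₁₎`. -/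
def triMap : (PA q ⊗[ℂ] Cq q) ⊗[ℂ] (PA q ⊗[ℂ] AU q) →ₗ[ℂ] PA q ⊗[ℂ] Cq q :=
  (TensorProduct.map (LinearMap.mul' ℂ (PA q)) (TensorProduct.lift (LinearMap.flip (cact q)))) ∘ₗ
    (TensorProduct.tensorTensorTensorComm ℂ (PA q) (Cq q) (PA q) (AU q)).toLinearMap

/-- The subspace `ℛ ⊗ A + A ⊗ ℛ`. -/
abbrev coM : Submodule ℂ (AU q ⊗[ℂ] AU q) :=
  LinearMap.range (TensorProduct.map (RIdeal q).subtype (LinearMap.id : AU q →ₗ[ℂ] AU q))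
    ⊔ LinearMap.range (TensorProduct.map (LinearMap.id : AU q →ₗ[ℂ] AU q) (RIdeal q).subtype)

lemma coM_left {x : AU q} (hx : x ∈ RIdeal q) (a : AU q) : x ⊗ₜ[ℂ] a ∈ coM q :=
  Submodule.mem_sup_left ⟨(⟨x, hx⟩ : RIdeal q) ⊗ₜ[ℂ] a, by simp⟩

lemma coM_right (a : AU q) {x : AU q} (hx : x ∈ RIdeal q) : a ⊗ₜ[ℂ] x ∈ coM q :=
  Submodule.mem_sup_right ⟨a ⊗ₜ[ℂ] (⟨x, hx⟩ : RIdeal q), by simp⟩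

lemma coM_mul {x : AU q ⊗[ℂ] AU q} (hx : x ∈ coM q) (c : AU q ⊗[ℂ] AU q) :
    x * c ∈ coM q := by
  induction c using TensorProduct.induction_on with
  | zero => rw [mul_zero]; exact Submodule.zero_mem _
  | add u v hu hv => rw [mul_add]; exact Submodule.add_mem _ hu hv
  | tmul a b =>
    obtain ⟨_, ⟨u, rfl⟩, _, ⟨v, rfl⟩, rfl⟩ := Submodule.mem_sup.mp hx
    rw [add_mul]
    refine Submodule.add_mem _ ?_ ?_
    · induction u using TensorProduct.induction_on with
      | zero => rw [map_zero, zero_mul]; exact Submodule.zero_mem _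
      | add u v hu hv =>
        rw [map_add, add_mul]
        refine Submodule.add_mem _ (hu ?_) (hv ?_)
        · exact Submodule.add_mem _ (Submodule.mem_sup_left ⟨_, rfl⟩)
            (Submodule.mem_sup_right ⟨_, rfl⟩)
        · exact Submodule.add_mem _ (Submodule.mem_sup_left ⟨_, rfl⟩)
            (Submodule.mem_sup_right ⟨_, rfl⟩)
      | tmul x y =>
        rw [TensorProduct.map_tmul, Algebra.TensorProduct.tmul_mul_tmul]
        exact coM_left q (RIdeal_mul_right q x.2 a) _
    · induction v using TensorProduct.induction_on with
      | zero => rw [map_zero, zero_mul]; exact Submodule.zero_mem _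
      | add u v hu hv =>
        rw [map_add, add_mul]
        refine Submodule.add_mem _ (hu ?_) (hv ?_)
        · exact Submodule.add_mem _ (Submodule.mem_sup_left ⟨_, rfl⟩)
            (Submodule.mem_sup_right ⟨_, rfl⟩)
        · exact Submodule.add_mem _ (Submodule.mem_sup_left ⟨_, rfl⟩)
            (Submodule.mem_sup_right ⟨_, rfl⟩)
      | tmul x y =>
        rw [TensorProduct.map_tmul, Algebra.TensorProduct.tmul_mul_tmul]
        exact coM_right q _ (RIdeal_mul_right q y.2 b)

lemma mem_of_Rset {x : AU q} (hx : x ∈ Rset q) : x ∈ RIdeal q :=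
  Submodule.subset_span ⟨x, hx, 1, (mul_one x).symm⟩

lemma tt_comm {i j k l : Fin 4} (h : i < j) (h' : k < l) :
    tt q i l * tt q j k = tt q j k * tt q i l := by
  simpa [tt] using RingQuot.mkAlgHom_rel ℂ (relU.comm (q := q) h h')

lemma tt_row {i j k : Fin 4} (h : i < j) :
    tt q k i * tt q k j = (q : ℂ) • (tt q k j * tt q k i) := by
  have := RingQuot.mkAlgHom_rel ℂ (relU.row (q := q) (k := k) h)
  simp only [map_mul, map_smul] at this
  exact this

lemma tt_qcom {i j k l : Fin 4} (h : i < j) (h' : k < l) :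
    tt q i k * tt q j l =
      tt q j l * tt q i k + ((q : ℂ) - (q : ℂ)⁻¹) • (tt q j k * tt q i l) := by
  have := RingQuot.mkAlgHom_rel ℂ (relU.qcom (q := q) h h')
  simp only [map_sub, map_mul, map_smul] at this
  rw [← sub_eq_iff_eq_add']
  exact this

/-- The quantum minor with rows `a, b` and columns `0, 1`. -/
def minc (a b : Fin 4) : AU q := tt q a 0 * tt q b 1 - (q : ℂ) • (tt q a 1 * tt q b 0)

lemma minc_self (a : Fin 4) : minc q a a = 0 := by
  unfold minc
  rw [tt_row q (i := 0) (j := 1) (by decide), sub_self]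

lemma minc_swap (hq : (q : ℂ) ≠ 0) : minc q 1 0 = (-(q : ℂ)) • minc q 0 1 := by
  unfold minc
  rw [tt_qcom q (i := 0) (j := 1) (k := 0) (l := 1) (by decide) (by decide),
    tt_comm q (i := 0) (j := 1) (k := 0) (l := 1) (by decide) (by decide)]
  simp only [smul_sub, smul_add, smul_smul]
  have e : -(q : ℂ) * ((q : ℂ) - (q : ℂ)⁻¹) = 1 + (-(q : ℂ) * q) := by
    field_simp
    ring
  rw [e, add_smul, one_smul, neg_smul]
  abel

lemma prod_mem {k l : Fin 4} (hkl : k < l) (h0 : tt q 0 l ∈ RIdeal q)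
    (h1 : tt q 1 l ∈ RIdeal q) : tt q 0 k * tt q 1 l ∈ RIdeal q := by
  rw [tt_qcom q (by decide) hkl, ← tt_comm q (i := 0) (j := 1) (by decide) hkl]
  exact Submodule.add_mem _ (RIdeal_mul_right q h1 _)
    (Submodule.smul_mem _ _ (RIdeal_mul_right q h0 _))

/-- Rewrites differences without using subtraction, so that images under `Δ` only use `+`, `•`. -/
lemma sub_eq_smul (x y : AU q) : x - y = x + (-1 : ℂ) • y := by
  rw [sub_eq_iff_eq_add]
  module

lemma sub_smul_eq (x y : AU q) : x - (-1 : ℂ) • y = x + y := by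
  rw [sub_eq_iff_eq_add]
  module

lemma coM_tmul_sub {a a' b b' : AU q} (h : a - a' ∈ RIdeal q) (h' : b - b' ∈ RIdeal q) :
    a ⊗ₜ[ℂ] b + (-1 : ℂ) • (a' ⊗ₜ[ℂ] b') ∈ coM q := by
  have e : a ⊗ₜ[ℂ] b + (-1 : ℂ) • (a' ⊗ₜ[ℂ] b')
      = (a + (-1 : ℂ) • a') ⊗ₜ[ℂ] b + a' ⊗ₜ[ℂ] (b + (-1 : ℂ) • b') := by
    rw [TensorProduct.add_tmul, TensorProduct.tmul_add, TensorProduct.tmul_smul,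
      ← TensorProduct.smul_tmul']
    module
  rw [e]
  refine Submodule.add_mem _ (coM_left q ?_ _) (coM_right q _ ?_)
  · rwa [← sub_eq_smul]
  · rwa [← sub_eq_smul]

lemma coM_tmul_sub' {a a' b b' : AU q} (h : a + a' ∈ RIdeal q) (h' : b + b' ∈ RIdeal q) :
    a ⊗ₜ[ℂ] b + (-1 : ℂ) • (a' ⊗ₜ[ℂ] b') ∈ coM q := by
  have := coM_tmul_sub q (a := a) (a' := (-1 : ℂ) • a') (b := b) (b' := (-1 : ℂ) • b')
    (by rwa [sub_smul_eq]) (by rwa [sub_smul_eq])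
  rw [TensorProduct.tmul_smul, ← TensorProduct.smul_tmul'] at this
  convert this using 1
  module

lemma coM_tmul_add {a a' b b' : AU q} (h : a - a' ∈ RIdeal q) (h' : b + b' ∈ RIdeal q) :
    a ⊗ₜ[ℂ] b + a' ⊗ₜ[ℂ] b' ∈ coM q := by
  have := coM_tmul_sub q (a := a) (a' := a') (b := b) (b' := (-1 : ℂ) • b')
    h (by rwa [sub_smul_eq])
  rw [TensorProduct.tmul_smul] at this
  convert this using 1
  module

lemma coM_tmul_add' {a a' b b' : AU q} (h : a + a' ∈ RIdeal q) (h' : b - b' ∈ RIdeal q) :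
    a ⊗ₜ[ℂ] b + a' ⊗ₜ[ℂ] b' ∈ coM q := by
  have := coM_tmul_sub q (a := a) (a' := (-1 : ℂ) • a') (b := b) (b' := b')
    (by rwa [sub_smul_eq]) h'
  rw [← TensorProduct.smul_tmul'] at this
  convert this using 1
  module

lemma quad_mem (hq : (q : ℂ) ≠ 0)
    (m02 : tt q 0 2 ∈ RIdeal q) (m03 : tt q 0 3 ∈ RIdeal q)
    (m12 : tt q 1 2 ∈ RIdeal q) (m13 : tt q 1 3 ∈ RIdeal q)
    (p5 : minc q 0 1 - 1 ∈ RIdeal q) :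
    (∑ k : Fin 4, ∑ l : Fin 4, (tt q 0 k * tt q 1 l) ⊗ₜ[ℂ] minc q k l)
      + (-1 : ℂ) • ((1 : AU q) ⊗ₜ[ℂ] (1 : AU q)) ∈ coM q := by
  have e : (∑ k : Fin 4, ∑ l : Fin 4, (tt q 0 k * tt q 1 l) ⊗ₜ[ℂ] minc q k l)
      + (-1 : ℂ) • ((1 : AU q) ⊗ₜ[ℂ] (1 : AU q)) =
      (minc q 0 1 ⊗ₜ[ℂ] minc q 0 1 + (-1 : ℂ) • ((1 : AU q) ⊗ₜ[ℂ] (1 : AU q)))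
      + ((tt q 0 0 * tt q 1 2) ⊗ₜ[ℂ] minc q 0 2 + (tt q 0 0 * tt q 1 3) ⊗ₜ[ℂ] minc q 0 3)
      + ((tt q 0 1 * tt q 1 2) ⊗ₜ[ℂ] minc q 1 2 + (tt q 0 1 * tt q 1 3) ⊗ₜ[ℂ] minc q 1 3)
      + (∑ l : Fin 4, (tt q 0 2 * tt q 1 l) ⊗ₜ[ℂ] minc q 2 l)
      + (∑ l : Fin 4, (tt q 0 3 * tt q 1 l) ⊗ₜ[ℂ] minc q 3 l) := by
    have e' : minc q 0 1 ⊗ₜ[ℂ] minc q 0 1 = (tt q 0 0 * tt q 1 1) ⊗ₜ[ℂ] minc q 0 1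
        + (tt q 0 1 * tt q 1 0) ⊗ₜ[ℂ] minc q 1 0 := by
      rw [minc_swap q hq, TensorProduct.tmul_smul, TensorProduct.smul_tmul',
        ← TensorProduct.add_tmul, neg_smul, ← sub_eq_add_neg]
      rfl
    rw [Fin.sum_univ_four (fun k => ∑ l : Fin 4, (tt q 0 k * tt q 1 l) ⊗ₜ[ℂ] minc q k l)]
    rw [e', Fin.sum_univ_four (fun l => (tt q 0 0 * tt q 1 l) ⊗ₜ[ℂ] minc q 0 l),
      Fin.sum_univ_four (fun l => (tt q 0 1 * tt q 1 l) ⊗ₜ[ℂ] minc q 1 l),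
      minc_self, minc_self, TensorProduct.tmul_zero, TensorProduct.tmul_zero]
    abel
  rw [e]
  refine Submodule.add_mem _ (Submodule.add_mem _ (Submodule.add_mem _ (Submodule.add_mem _
    (coM_tmul_sub q p5 p5) ?_) ?_) ?_) ?_
  · exact Submodule.add_mem _ (coM_left q (prod_mem q (by decide) m02 m12) _)
      (coM_left q (prod_mem q (by decide) m03 m13) _)
  · exact Submodule.add_mem _ (coM_left q (prod_mem q (by decide) m02 m12) _)
      (coM_left q (prod_mem q (by decide) m03 m13) _)
  · exact Submodule.sum_mem _ fun l _ => coM_left q (RIdeal_mul_right q m02 _) _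
  · exact Submodule.sum_mem _ fun l _ => coM_left q (RIdeal_mul_right q m03 _) _

theorem RIdeal_coideal_and_kappa_invariant (q : ℝ) (hq0 : 0 < q) (hq1 : q < 1)
    [StarRing (AU q)] [StarModule ℂ (AU q)]
    (S : AU q →ₗ[ℂ] AU q)
    (hSanti : ∀ x y : AU q, S (x * y) = S y * S x) (hS1 : S 1 = 1)
    (hSleft : ∀ i j : Fin 4, ∑ k : Fin 4, S (tt q i k) * tt q k j = if i = j then 1 else 0)
    (hSright : ∀ i j : Fin 4, ∑ k : Fin 4, tt q i k * S (tt q k j) = if i = j then 1 else 0)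
    (hSD : S (Dq q) = dI q) (hSDi : S (dI q) = Dq q)
    (hstarT : ∀ i j : Fin 4, star (tt q i j) = S (tt q j i))
    (hstarD : star (Dq q) = dI q)
    (Δc : AU q →ₐ[ℂ] AU q ⊗[ℂ] AU q)
    (hΔt : ∀ i j : Fin 4, Δc (tt q i j) = ∑ k : Fin 4, tt q i k ⊗ₜ[ℂ] tt q k j)
    (hΔD : Δc (Dq q) = Dq q ⊗ₜ[ℂ] Dq q) (hΔDi : Δc (dI q) = dI q ⊗ₜ[ℂ] dI q)
    (ε : AU q →ₐ[ℂ] ℂ)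
    (hεt : ∀ i j : Fin 4, ε (tt q i j) = if i = j then 1 else 0) (hεD : ε (dI q) = 1)
        : (∀ y ∈ RIdeal q, Δc y ∈
        LinearMap.range (TensorProduct.map (RIdeal q).subtype (LinearMap.id : AU q →ₗ[ℂ] AU q))
        ⊔ LinearMap.range (TensorProduct.map (LinearMap.id : AU q →ₗ[ℂ] AU q) (RIdeal q).subtype))
    ∧ (∀ y ∈ RIdeal q, ε y = 0)
    ∧ (∀ y ∈ RIdeal q, star (S y) ∈ RIdeal q) := by
  have hqc : (q : ℂ) ≠ 0 := by exact_mod_cast hq0.ne'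
  have m02 : tt q 0 2 ∈ RIdeal q := mem_of_Rset q (by simp [Rset])
  have m20 : tt q 2 0 ∈ RIdeal q := mem_of_Rset q (by simp [Rset])
  have m03 : tt q 0 3 ∈ RIdeal q := mem_of_Rset q (by simp [Rset])
  have m30 : tt q 3 0 ∈ RIdeal q := mem_of_Rset q (by simp [Rset])
  have m13 : tt q 1 3 ∈ RIdeal q := mem_of_Rset q (by simp [Rset])
  have m31 : tt q 3 1 ∈ RIdeal q := mem_of_Rset q (by simp [Rset])
  have m12 : tt q 1 2 ∈ RIdeal q := mem_of_Rset q (by simp [Rset])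
  have m21 : tt q 2 1 ∈ RIdeal q := mem_of_Rset q (by simp [Rset])
  have p1 : tt q 0 0 - tt q 3 3 ∈ RIdeal q := mem_of_Rset q (by simp [Rset])
  have p2 : tt q 0 1 + tt q 3 2 ∈ RIdeal q := mem_of_Rset q (by simp [Rset])
  have p3 : tt q 1 0 + tt q 2 3 ∈ RIdeal q := mem_of_Rset q (by simp [Rset])
  have p4 : tt q 1 1 - tt q 2 2 ∈ RIdeal q := mem_of_Rset q (by simp [Rset])
  have p5 : tt q 0 0 * tt q 1 1 - (q : ℂ) • (tt q 0 1 * tt q 1 0) - 1 ∈ RIdeal q :=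
    mem_of_Rset q (by simp [Rset])
  have c01 := tt_comm q (i := 0) (j := 1) (k := 0) (l := 1) (by decide) (by decide)
  refine ⟨?_, ?_, ?_⟩
  · have hR : ∀ x ∈ Rset q, Δc x ∈ coM q := by
      intro x hx
      simp only [Rset, Set.mem_insert_iff, Set.mem_singleton_iff] at hx
      rcases hx with rfl | rfl | rfl | rfl | rfl | rfl | rfl | rfl | rfl | rfl | rfl | rfl | rfl
      iterate 8
        rw [hΔt, Fin.sum_univ_four]
        refine Submodule.add_mem _ (Submodule.add_mem _ (Submodule.add_mem _ ?_ ?_) ?_) ?_ <;>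
          first
          | exact coM_left q (by assumption) _
          | exact coM_right q _ (by assumption)
      · rw [sub_eq_smul, map_add, map_smul, hΔt, hΔt, Fin.sum_univ_four, Fin.sum_univ_four]
        have h := Submodule.add_mem _ (Submodule.add_mem _ (coM_tmul_sub q p1 p1)
          (coM_tmul_sub' q p2 p3)) (Submodule.add_mem _ (Submodule.add_mem _ (coM_left q m02 (tt q 2 0))
          (coM_left q m03 (tt q 3 0))) (Submodule.smul_mem _ (-1 : ℂ) (Submodule.add_mem _
          (coM_left q m30 (tt q 0 3)) (coM_left q m31 (tt q 1 3)))))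
        convert h using 1
        module
      · rw [map_add, hΔt, hΔt, Fin.sum_univ_four, Fin.sum_univ_four]
        have h := Submodule.add_mem _ (Submodule.add_mem _ (coM_tmul_add q p1 p2)
          (coM_tmul_add' q p2 p4)) (Submodule.add_mem _ (Submodule.add_mem _
          (coM_left q m02 (tt q 2 1))
          (coM_left q m03 (tt q 3 1))) (Submodule.add_mem _ (coM_left q m30 (tt q 0 2))
          (coM_left q m31 (tt q 1 2))))
        convert h using 1
        module
      · rw [map_add, hΔt, hΔt, Fin.sum_univ_four, Fin.sum_univ_four]
        have h := Submodule.add_mem _ (Submodule.add_mem _ (coM_tmul_add' q p3 p1)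
          (coM_tmul_add q p4 p3)) (Submodule.add_mem _ (Submodule.add_mem _
          (coM_left q m12 (tt q 2 0))
          (coM_left q m13 (tt q 3 0))) (Submodule.add_mem _ (coM_left q m20 (tt q 0 3))
          (coM_left q m21 (tt q 1 3))))
        convert h using 1
        module
      · rw [sub_eq_smul, map_add, map_smul, hΔt, hΔt, Fin.sum_univ_four, Fin.sum_univ_four]
        have h := Submodule.add_mem _ (Submodule.add_mem _ (coM_tmul_sub' q p3 p2)
          (coM_tmul_sub q p4 p4)) (Submodule.add_mem _ (Submodule.add_mem _ (coM_left q m12 (tt q 2 1))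
          (coM_left q m13 (tt q 3 1))) (Submodule.smul_mem _ (-1 : ℂ) (Submodule.add_mem _
          (coM_left q m20 (tt q 0 2)) (coM_left q m21 (tt q 1 2)))))
        convert h using 1
        module
      · have h := quad_mem q hqc m02 m03 m12 m13 p5
        have e : Δc (tt q 0 0 * tt q 1 1 - (q : ℂ) • (tt q 0 1 * tt q 1 0) - 1) =
            (∑ k : Fin 4, ∑ l : Fin 4, (tt q 0 k * tt q 1 l) ⊗ₜ[ℂ] minc q k l)
            + (-1 : ℂ) • ((1 : AU q) ⊗ₜ[ℂ] (1 : AU q)) := by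
          rw [sub_eq_smul, sub_eq_smul, map_add, map_add, map_smul, map_smul, map_smul, map_mul,
            map_mul, map_one, hΔt, hΔt, hΔt, hΔt, Finset.sum_mul_sum, Finset.sum_mul_sum]
          simp only [Finset.smul_sum, ← Finset.sum_add_distrib,
            Algebra.TensorProduct.tmul_mul_tmul, minc, sub_eq_smul, TensorProduct.tmul_add,
            TensorProduct.tmul_smul]
          rfl
        rw [e]
        exact h
    intro y hy
    change Δc y ∈ coM q
    induction hy using Submodule.span_induction with
    | mem x hx =>
        obtain ⟨x0, hx0, a, rfl⟩ := hx
        rw [map_mul]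
        exact coM_mul q (hR x0 hx0) _
    | zero => rw [map_zero]; exact Submodule.zero_mem _
    | add u v _ _ hu hv => rw [map_add]; exact Submodule.add_mem _ hu hv
    | smul a u _ hu => rw [map_smul]; exact Submodule.smul_mem _ a hu
  · intro y hy
    induction hy using Submodule.span_induction with
    | mem x hx =>
        obtain ⟨x0, hx0, a, rfl⟩ := hx
        rw [map_mul]
        have : ε x0 = 0 := by
          simp only [Rset, Set.mem_insert_iff, Set.mem_singleton_iff] at hx0
          rcases hx0 with rfl | rfl | rfl | rfl | rfl | rfl | rfl | rfl | rfl | rfl | rfl | rfl |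
            rfl <;> simp [hεt]
        rw [this, zero_mul]
    | zero => rw [map_zero]
    | add u v _ _ hu hv => rw [map_add, hu, hv, add_zero]
    | smul a u _ hu => rw [map_smul, hu, smul_zero]
  · have hk : ∀ i j, star (S (tt q i j)) = tt q j i := by
      intro i j
      rw [← hstarT, star_star]
    intro y hy
    induction hy using Submodule.span_induction with
    | mem x hx =>
        obtain ⟨x0, hx0, a, rfl⟩ := hx
        rw [hSanti, star_mul]
        refine RIdeal_mul_right q ?_ _
        simp only [Rset, Set.mem_insert_iff, Set.mem_singleton_iff] at hx0
        rcases hx0 with rfl | rfl | rfl | rfl | rfl | rfl | rfl | rfl | rfl | rfl | rfl | rfl |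
            rfl
        all_goals
          simp only [map_sub, map_add, map_smul, hSanti, hS1, star_sub, star_add, star_smul,
            star_mul, hk, star_one]
        all_goals first
          | assumption
          | skip
        rw [← c01]
        simpa using p5
    | zero => simp
    | add u v _ _ hu hv => rw [map_add, star_add]; exact Submodule.add_mem _ hu hv
    | smul a u _ hu => rw [map_smul, star_smul]; exact Submodule.smul_mem _ _ hu

end QIB
end
end

section
/- In A(S^7_q), the elements a = z_1 z_4* − z_2 z_3*, b = z_1 z_3 + q^{-1} z_2 z_4 and R = z_1 z_1* + z_2 z_2* satisfy: R a = q^{-2} a R, R b = q^2 b R, a b = q^3 b a, a b* = q^{-1} b* a, a a* + q^2 b b* = R(1 − q^2 R), a a* = q^2 a* a + (1 − q^2) R^2, and b* b = q^4 b b* + (1 − q^2) R. -/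
open scoped TensorProduct

noncomputable section

namespace QIB

variable (q : ℝ)

/-! ### The coaction, the coinvariants and the canonical map -/

variable (δ : PA q →ₐ[ℂ] PA q ⊗[ℂ] AU q)

lemma reassoc_aux {S : Type*} [Semigroup S] {a b c : S} (h : a * b = c) (w : S) :
    a * (b * w) = c * w := by rw [← mul_assoc, h]

set_option maxHeartbeats 4000000 in
/-- The relations, in any algebra with eight elements obeying the sphere relations
(written as rewriting rules to a normal form). -/
lemma relations_aux {S : Type*} [Ring S] [Algebra ℂ S] (r : ℂ) (hr : r ≠ 0)
    (x0 x1 x2 x3 y0 y1 y2 y3 : S)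
    (hx10 : x1 * x0 = r⁻¹ • (x0 * x1))
    (hy01 : y0 * y1 = r⁻¹ • (y1 * y0))
    (hx20 : x2 * x0 = r⁻¹ • (x0 * x2))
    (hy02 : y0 * y2 = r⁻¹ • (y2 * y0))
    (hx21 : x2 * x1 = r⁻¹ • (x1 * x2))
    (hy12 : y1 * y2 = r⁻¹ • (y2 * y1))
    (hx30 : x3 * x0 = r⁻¹ • (x0 * x3))
    (hy03 : y0 * y3 = r⁻¹ • (y3 * y0))
    (hx31 : x3 * x1 = r⁻¹ • (x1 * x3))
    (hy13 : y1 * y3 = r⁻¹ • (y3 * y1))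
    (hx32 : x3 * x2 = r⁻¹ • (x2 * x3))
    (hy23 : y2 * y3 = r⁻¹ • (y3 * y2))
    (hs10 : y1 * x0 = r • (x0 * y1))
    (hs20 : y2 * x0 = r • (x0 * y2))
    (hs30 : y3 * x0 = r • (x0 * y3))
    (hs01 : y0 * x1 = r • (x1 * y0))
    (hs21 : y2 * x1 = r • (x1 * y2))
    (hs31 : y3 * x1 = r • (x1 * y3))
    (hs02 : y0 * x2 = r • (x2 * y0))
    (hs12 : y1 * x2 = r • (x2 * y1))
    (hs32 : y3 * x2 = r • (x2 * y3))
    (hs03 : y0 * x3 = r • (x3 * y0))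
    (hs13 : y1 * x3 = r • (x3 * y1))
    (hs23 : y2 * x3 = r • (x3 * y2))
    (hd0 : y0 * x0 = x0 * y0)
    (hd1 : y1 * x1 = x1 * y1 + (1 - r ^ 2) • (x0 * y0))
    (hd2 : y2 * x2 = x2 * y2 + (1 - r ^ 2) • (x0 * y0 + x1 * y1))
    (hd3 : y3 * x3 = x3 * y3 + (1 - r ^ 2) • (x0 * y0 + x1 * y1 + x2 * y2))
    (hu : x3 * y3 = 1 - x0 * y0 - x1 * y1 - x2 * y2) :
    (x0 * y0 + x1 * y1) * (x0 * y3 - x1 * y2) = (r ^ (-2 : ℤ)) • ((x0 * y3 - x1 * y2) * (x0 * y0 + x1 * y1)) ∧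
    (x0 * y0 + x1 * y1) * (x0 * x2 + r⁻¹ • (x1 * x3)) = (r ^ 2) • ((x0 * x2 + r⁻¹ • (x1 * x3)) * (x0 * y0 + x1 * y1)) ∧
    (x0 * y3 - x1 * y2) * (x0 * x2 + r⁻¹ • (x1 * x3)) = (r ^ 3) • ((x0 * x2 + r⁻¹ • (x1 * x3)) * (x0 * y3 - x1 * y2)) ∧
    (x0 * y3 - x1 * y2) * (y2 * y0 + r⁻¹ • (y3 * y1)) = r⁻¹ • ((y2 * y0 + r⁻¹ • (y3 * y1)) * (x0 * y3 - x1 * y2)) ∧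
    (x0 * y3 - x1 * y2) * (x3 * y0 - x2 * y1) + (r ^ 2) • ((x0 * x2 + r⁻¹ • (x1 * x3)) * (y2 * y0 + r⁻¹ • (y3 * y1))) = (x0 * y0 + x1 * y1) * (1 - (r ^ 2) • (x0 * y0 + x1 * y1)) ∧
    (x0 * y3 - x1 * y2) * (x3 * y0 - x2 * y1) = (r ^ 2) • ((x3 * y0 - x2 * y1) * (x0 * y3 - x1 * y2)) + (1 - r ^ 2) • (x0 * y0 + x1 * y1) ^ 2 ∧
    (y2 * y0 + r⁻¹ • (y3 * y1)) * (x0 * x2 + r⁻¹ • (x1 * x3)) = (r ^ 4) • ((x0 * x2 + r⁻¹ • (x1 * x3)) * (y2 * y0 + r⁻¹ • (y3 * y1))) + (1 - r ^ 2) • (x0 * y0 + x1 * y1) := by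
  refine ⟨?_, ?_, ?_, ?_, ?_, ?_, ?_⟩
  all_goals
    simp only [pow_two ((x0 * y0 + x1 * y1)), mul_assoc, mul_add, add_mul, mul_sub, sub_mul, mul_smul_comm, smul_mul_assoc,
      smul_add, smul_sub, smul_smul, mul_one, one_mul,
      hx10, hy01, hx20, hy02, hx21, hy12, hx30, hy03, hx31, hy13, hx32, hy23, hs10, hs20, hs30, hs01, hs21, hs31, hs02, hs12, hs32, hs03, hs13, hs23, hd0, hd1, hd2, hd3, hu,
      reassoc_aux hx10, reassoc_aux hy01, reassoc_aux hx20, reassoc_aux hy02, reassoc_aux hx21, reassoc_aux hy12, reassoc_aux hx30, reassoc_aux hy03, reassoc_aux hx31, reassoc_aux hy13, reassoc_aux hx32, reassoc_aux hy23, reassoc_aux hs10, reassoc_aux hs20, reassoc_aux hs30, reassoc_aux hs01, reassoc_aux hs21, reassoc_aux hs31, reassoc_aux hs02, reassoc_aux hs12, reassoc_aux hs32, reassoc_aux hs03, reassoc_aux hs13, reassoc_aux hs23, reassoc_aux hd0, reassoc_aux hd1, reassoc_aux hd2, reassoc_aux hd3, reassoc_aux hu]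
    match_scalars <;> field_simp <;> ring

theorem sigma4_relations (q : ℝ) (hq0 : 0 < q) (hq1 : q < 1)
    [StarRing (PA q)] [StarModule ℂ (PA q)]
    (hstarz : ∀ i : Fin 4, star (z q i) = zs q i)
    : RRe q * aa q = ((q : ℂ) ^ (-2 : ℤ)) • (aa q * RRe q) ∧
    RRe q * bb q = ((q : ℂ) ^ 2) • (bb q * RRe q) ∧
    aa q * bb q = ((q : ℂ) ^ 3) • (bb q * aa q) ∧
    aa q * star (bb q) = (q : ℂ)⁻¹ • (star (bb q) * aa q) ∧
    aa q * star (aa q) + ((q : ℂ) ^ 2) • (bb q * star (bb q))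
      = RRe q * (1 - ((q : ℂ) ^ 2) • RRe q) ∧
    aa q * star (aa q) = ((q : ℂ) ^ 2) • (star (aa q) * aa q) + (1 - (q : ℂ) ^ 2) • RRe q ^ 2 ∧
    star (bb q) * bb q = ((q : ℂ) ^ 4) • (bb q * star (bb q)) + (1 - (q : ℂ) ^ 2) • RRe q := by
  have hr : (q : ℂ) ≠ 0 := by exact_mod_cast hq0.ne'
  have key : ∀ {u v : FS}, relS q u v →
      RingQuot.mkAlgHom ℂ (relS q) u = RingQuot.mkAlgHom ℂ (relS q) v :=
    fun h => RingQuot.mkAlgHom_rel ℂ h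
  have hx : ∀ i j : Fin 4, i < j → z q j * z q i = (q : ℂ)⁻¹ • (z q i * z q j) := by
    intro i j hij
    have h := key (relS.zz (q := q) hij)
    simp only [map_mul, map_smul] at h
    rw [eq_inv_smul_iff₀ hr]
    exact h.symm
  have hy : ∀ i j : Fin 4, i < j → zs q i * zs q j = (q : ℂ)⁻¹ • (zs q j * zs q i) := by
    intro i j hij
    have h := key (relS.ss (q := q) hij)
    simp only [map_mul, map_smul] at h
    rw [eq_inv_smul_iff₀ hr]
    exact h.symm
  have hs : ∀ i j : Fin 4, i ≠ j → zs q j * z q i = (q : ℂ) • (z q i * zs q j) := by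
    intro i j hij
    have h := key (relS.sz (q := q) hij)
    simp only [map_mul, map_smul] at h
    exact h
  have hd : ∀ k : Fin 4, zs q k * z q k = z q k * zs q k + (1 - (q : ℂ) ^ 2) •
        ∑ j ∈ Finset.univ.filter (· < k), z q j * zs q j := by
    intro k
    have h := key (relS.szz (q := q) (k := k))
    simp only [map_mul, map_smul, map_add, map_sum] at h
    exact h
  have hu : ∑ k : Fin 4, z q k * zs q k = 1 := by
    have h := key (relS.sum1 (q := q))
    simp only [map_mul, map_one, map_sum] at h
    exact h
  have hd0 := hd 0
  have hd1 := hd 1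
  have hd2 := hd 2
  have hd3 := hd 3
  rw [show (Finset.univ.filter (· < (0 : Fin 4))) = ∅ by decide] at hd0
  rw [show (Finset.univ.filter (· < (1 : Fin 4))) = {0} by decide] at hd1
  rw [show (Finset.univ.filter (· < (2 : Fin 4))) = {0, 1} by decide] at hd2
  rw [show (Finset.univ.filter (· < (3 : Fin 4))) = {0, 1, 2} by decide] at hd3
  simp only [Finset.sum_empty, smul_zero, add_zero] at hd0
  simp only [Finset.sum_singleton] at hd1
  rw [Finset.sum_pair (by decide)] at hd2
  rw [Finset.sum_insert (by decide), Finset.sum_pair (by decide), ← add_assoc] at hd3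
  rw [Fin.sum_univ_four] at hu
  have hu' : z q 3 * zs q 3 = 1 - z q 0 * zs q 0 - z q 1 * zs q 1 - z q 2 * zs q 2 := by
    rw [← hu]; abel
  have hzs : ∀ i : Fin 4, star (zs q i) = z q i := fun i => by rw [← hstarz, star_star]
  have hA : star (aa q) = z q 3 * zs q 0 - z q 2 * zs q 1 := by
    simp only [aa, star_sub, star_mul, hstarz, hzs]
  have hB : star (bb q) = zs q 2 * zs q 0 + (q : ℂ)⁻¹ • (zs q 3 * zs q 1) := by
    simp only [bb, star_add, star_mul, star_smul, hstarz, star_inv₀, Complex.star_def,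
      Complex.conj_ofReal]
  rw [hA, hB]
  simp only [RRe, aa, bb, hstarz]
  exact relations_aux (q : ℂ) hr (z q 0) (z q 1) (z q 2) (z q 3)
    (zs q 0) (zs q 1) (zs q 2) (zs q 3)
    (hx 0 1 (by decide)) (hy 0 1 (by decide)) (hx 0 2 (by decide)) (hy 0 2 (by decide))
    (hx 1 2 (by decide)) (hy 1 2 (by decide)) (hx 0 3 (by decide)) (hy 0 3 (by decide))
    (hx 1 3 (by decide)) (hy 1 3 (by decide)) (hx 2 3 (by decide)) (hy 2 3 (by decide))
    (hs 0 1 (by decide)) (hs 0 2 (by decide)) (hs 0 3 (by decide)) (hs 1 0 (by decide))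
    (hs 1 2 (by decide)) (hs 1 3 (by decide)) (hs 2 0 (by decide)) (hs 2 1 (by decide))
    (hs 2 3 (by decide)) (hs 3 0 (by decide)) (hs 3 1 (by decide)) (hs 3 2 (by decide))
    hd0 hd1 hd2 hd3
    hu'

end QIB
end
end
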